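/- arXiv:2509.17780 — 2 statements merged into one kernel-verified Lean document; each statement's English description precedes it below -/
import Mathlib

section
/- There exists a finite group P of order 3^7 such that P has derived length exactly 3 (P'' ≠ 1 and P''' = 1), P has a normal subgroup G which is an extraspecial 3-group of order 3^5 and exponent 3 with P/G cyclic of order 9, and cd(P) = {1, 3, 9}. -/
/-- A finite group `G` is an extraspecial `p`-group if its center, derived subgroup
and Frattini subgroup all coincide and have order `p`. -/
def IsExtraspecial (p : ℕ) (G : Type*) [Group G] : Prop :=
  IsPGroup p G ∧ Subgroup.center G = commutator G ∧
    commutator G = frattini G ∧ Nat.card (Subgroup.center G) = p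

/-- The set of character degrees of `G`: the dimensions of the simple
finite-dimensional complex representations of `G`. -/
def charDegrees (G : Type) [Group G] : Set ℕ :=
  {d | ∃ V : FDRep ℂ G, CategoryTheory.Simple V ∧ Module.finrank ℂ V = d}

open CategoryTheory Module

namespace FDRep

/-- The underlying representation of a simple object of `FDRep k G` is irreducible. -/
theorem isIrreducible_of_simple {k : Type} {G : Type} [Field k] [Group G] (V : FDRep k G)
    [Simple V] : Representation.IsIrreducible V.ρ := by
  have hnt : Nontrivial V := by
    by_contra hV
    rw [not_nontrivial_iff_subsingleton] at hV
    refine id_nonzero V ?_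
    ext x
    exact Subsingleton.elim (α := V) _ _
  have : Nontrivial (Subrepresentation V.ρ) := by
    refine ⟨⟨⊥, ⊤, fun h ↦ ?_⟩⟩
    exact bot_ne_top (α := Submodule k V) (congrArg Subrepresentation.toSubmodule h)
  refine ⟨fun W ↦ or_iff_not_imp_left.mpr fun hW ↦ ?_⟩
  let ι : FDRep.of W.toRepresentation ⟶ V :=
    forget₂HomLinearEquiv _ _ (Rep.ofHom ⟨W.toSubmodule.subtype, fun g ↦ rfl⟩)
  have hι : ∀ x : W.toSubmodule, ι.hom.hom.hom x = (x : V) := fun x ↦ rfl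
  have : Mono ι := by
    refine ⟨fun f g hfg ↦ ?_⟩
    ext x
    have := congrArg (fun t ↦ t.hom.hom.hom x) hfg
    exact this
  have hne : ι ≠ 0 := by
    intro h0
    refine hW ?_
    refine Subrepresentation.toSubmodule_injective ((Submodule.eq_bot_iff _).mpr fun x hx ↦ ?_)
    have := congrArg (fun t ↦ t.hom.hom.hom (⟨x, hx⟩ : W.toSubmodule)) h0
    exact this
  have := isIso_of_mono_of_nonzero hne
  refine Subrepresentation.toSubmodule_injective ((Submodule.eq_top_iff').mpr fun x ↦ ?_)
  have := congrArg (fun t ↦ t.hom.hom.hom x) (IsIso.inv_hom_id ι)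
  have h2 : ((inv ι).hom.hom.hom x : W.toSubmodule).1 = x := this
  rw [← h2]
  exact Subtype.property _

/-- An irreducible representation of a finite group over an algebraically closed field of
characteristic zero gives a simple object of `FDRep k G`. -/
theorem simple_of_isIrreducible {k : Type} {G : Type} [Field k] [IsAlgClosed k] [CharZero k]
    [Group G] [Finite G] {V : Type} [AddCommGroup V] [Module k V] [FiniteDimensional k V]
    (ρ : Representation k G V) [ρ.IsIrreducible] : Simple (FDRep.of ρ) := by
  rw [simple_iff_end_is_rank_one, ← (forget₂HomLinearEquiv _ _).finrank_eq,
    ← Representation.IsIrreducible.finrank_intertwiningMap_self ρ]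
  exact LinearEquiv.finrank_eq (Rep.homLinearEquiv _ _)

end FDRep

namespace Representation

variable {k G V : Type*} [Field k] [Group G] [AddCommGroup V] [Module k V]

/-- Nonzero vectors on which `G` acts through pairwise distinct characters are
linearly independent. -/
theorem linearIndependent_of_weights (ρ : Representation k G V) {ι : Type*} {x : ι → V}
    {χ : ι → G →* k} (hχ : Function.Injective χ) (hx : ∀ i, x i ≠ 0)
    (h : ∀ i g, ρ g (x i) = χ i g • x i) : LinearIndependent k x := by
  rw [linearIndependent_iff']
  intro s c hc i hi
  have hzero : ∀ φ : Dual k V, c i * φ (x i) = 0 := by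
    intro φ
    have hli := (linearIndependent_monoidHom G k).comp χ hχ
    rw [linearIndependent_iff'] at hli
    refine hli s (fun j ↦ c j * φ (x j)) ?_ i hi
    ext g
    have := congrArg (fun w ↦ φ (ρ g w)) hc
    simp only [map_sum, map_smul, h, map_zero, smul_eq_mul] at this
    simp only [Function.comp_apply, Finset.sum_apply, Pi.smul_apply, smul_eq_mul, Pi.zero_apply]
    rw [← this]
    exact Finset.sum_congr rfl fun j _ ↦ by ring
  by_contra hci
  refine hx i ((Module.forall_dual_apply_eq_zero_iff k (x i)).mp fun φ ↦ ?_)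
  exact (mul_eq_zero.mp (hzero φ)).resolve_left hci

/-- A group acting by pairwise commuting operators on a nonzero finite-dimensional space over an
algebraically closed field has a common eigenvector. -/
theorem exists_weight_of_commute [IsAlgClosed k] [FiniteDimensional k V] [Nontrivial V]
    (ρ : Representation k G V) (hρ : ∀ g h, Commute (ρ g) (ρ h)) :
    ∃ (χ : G →* k) (v : V), v ≠ 0 ∧ ∀ g, ρ g v = χ g • v := by
  let S : Set (Submodule k V) := {W | W ≠ ⊥ ∧ ∀ g, ∀ w ∈ W, ρ g w ∈ W}
  obtain ⟨W, ⟨hW0, hWinv⟩, hmin⟩ :=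
    (wellFounded_lt (α := Submodule k V)).has_min S ⟨⊤, top_ne_bot, fun _ _ _ ↦ Submodule.mem_top⟩
  have hscalar : ∀ g, ∃ c : k, ∀ w ∈ W, ρ g w = c • w := by
    intro g
    have : Nontrivial W := (Submodule.nontrivial_iff_ne_bot).mpr hW0
    obtain ⟨c, hc⟩ := Module.End.exists_eigenvalue ((ρ g).restrict (hWinv g))
    obtain ⟨w, hw⟩ := hc.exists_hasEigenvector
    refine ⟨c, fun y hy ↦ ?_⟩
    have hE : W ⊓ Module.End.eigenspace (ρ g) c ∈ S := by
      refine ⟨fun hbot ↦ hw.2 ?_, fun h y hy ↦ ⟨hWinv h y hy.1, ?_⟩⟩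
      · have : (w : V) ∈ W ⊓ Module.End.eigenspace (ρ g) c :=
          ⟨w.2, Module.End.mem_eigenspace_iff.mpr (congrArg Subtype.val hw.apply_eq_smul)⟩
        rw [hbot] at this
        exact Subtype.ext this
      · have hyE := Module.End.mem_eigenspace_iff.mp hy.2
        refine Module.End.mem_eigenspace_iff.mpr ?_
        rw [← Module.End.mul_apply, (hρ g h).eq, Module.End.mul_apply, hyE, map_smul]
    have hle := not_lt_iff_le_imp_ge.mp (hmin _ hE) inf_le_left
    exact Module.End.mem_eigenspace_iff.mp (hle hy).2
  choose c hc using hscalar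
  obtain ⟨v, hv, hv0⟩ := W.exists_mem_ne_zero_of_ne_bot hW0
  refine ⟨⟨⟨c, ?_⟩, fun g h ↦ ?_⟩, v, hv0, fun g ↦ hc g v hv⟩
  · refine smul_left_injective k hv0 ?_
    simp [← hc 1 v hv]
  · refine smul_left_injective k hv0 ?_
    change c (g * h) • v = (c g * c h) • v
    rw [← hc _ v hv, map_mul, Module.End.mul_apply, hc h v hv, map_smul, hc g v hv, smul_smul,
      mul_comm]

/-- Clifford theory in the case of a linear character with cyclic inertia quotient: if an
irreducible representation has a nonzero vector of weight `χ` for a normal subgroup `N`, and the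
stabilizer `H` of `χ` is generated modulo `N` by one element, then the degree is the index
of `H`. -/
theorem finrank_eq_index_of_weight [IsAlgClosed k] [FiniteDimensional k V] [Finite G]
    (ρ : Representation k G V) [ρ.IsIrreducible] {N H : Subgroup G} [N.Normal] (χ : N →* k)
    {v : V} (hv : v ≠ 0) (hχ : ∀ n : N, ρ n v = χ n • v)
    (hH : ∀ g, g ∈ H ↔ ∀ n : N, χ (MulAut.conjNormal g n) = χ n)
    {h : G} (hh : h ∈ H) (hgen : ∀ g ∈ H, ∃ n ∈ N, ∃ m : ℕ, g = n * h ^ m) :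
    finrank k V = H.index := by
  have hconj : ∀ (w : V), (∀ n : N, ρ n w = χ n • w) → ∀ (g : G) (n : N),
      ρ n (ρ g w) = χ (MulAut.conjNormal g⁻¹ n) • ρ g w := by
    intro w hw g n
    rw [← map_smul, ← hw, ← Module.End.mul_apply, ← Module.End.mul_apply, ← map_mul, ← map_mul]
    congr 2
    simp [mul_assoc]
  obtain ⟨w, hw0, hwN, c, hwh⟩ :
      ∃ w : V, w ≠ 0 ∧ (∀ n : N, ρ n w = χ n • w) ∧ ∃ c : k, ρ h w = c • w := by
    let W : Submodule k V := ⨅ n : N, Module.End.eigenspace (ρ n) (χ n)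
    have hmemW : ∀ w, w ∈ W ↔ ∀ n : N, ρ n w = χ n • w := fun w ↦ by
      simp [W, Submodule.mem_iInf]
    have hinv : ∀ w ∈ W, ρ h w ∈ W := fun w hw ↦ (hmemW _).mpr fun n ↦ by
      rw [hconj w ((hmemW w).mp hw) h n, (hH h⁻¹).mp (H.inv_mem hh) n]
    have : Nontrivial W := ⟨⟨⟨v, (hmemW v).mpr hχ⟩, 0, fun h0 ↦ hv (congrArg Subtype.val h0)⟩⟩
    obtain ⟨c, hc⟩ := Module.End.exists_eigenvalue ((ρ h).restrict hinv)
    obtain ⟨w, hw⟩ := hc.exists_hasEigenvector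
    exact ⟨w, fun h0 ↦ hw.2 (Subtype.ext h0), (hmemW _).mp w.2, c,
      congrArg Subtype.val hw.apply_eq_smul⟩
  have hpow : ∀ m : ℕ, ρ (h ^ m) w = c ^ m • w := by
    intro m
    induction m with
    | zero => simp
    | succ m ih => rw [pow_succ, map_mul, Module.End.mul_apply, hwh, map_smul, ih, smul_smul,
        pow_succ, mul_comm]
  have hHw : ∀ g ∈ H, ∃ a : k, ρ g w = a • w := by
    intro g hg
    obtain ⟨n, hn, m, rfl⟩ := hgen g hg
    exact ⟨c ^ m * χ ⟨n, hn⟩, by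
      rw [map_mul, Module.End.mul_apply, hpow, map_smul, hwN ⟨n, hn⟩, smul_smul]⟩
  let x : G ⧸ H → V := fun q ↦ ρ q.out w
  have hx0 : ∀ q, x q ≠ 0 := fun q h0 ↦ hw0 <| by
    simpa [x] using congrArg (ρ q.out⁻¹) h0
  have hli : LinearIndependent k x := by
    refine linearIndependent_of_weights (ρ.comp N.subtype)
      (χ := fun q ↦ χ.comp (MulAut.conjNormal (H := N) q.out⁻¹).toMonoidHom) ?_ hx0
      fun q n ↦ hconj w hwN q.out n
    intro q r hqr
    rw [← q.out_eq', ← r.out_eq']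
    refine (QuotientGroup.eq.mpr ((hH _).mpr fun n ↦ ?_))
    have := DFunLike.congr_fun hqr (MulAut.conjNormal r.out n)
    have hr : MulAut.conjNormal r.out⁻¹ (MulAut.conjNormal r.out n) = n := by
      rw [← MulAut.mul_apply, ← map_mul, inv_mul_cancel, map_one, MulAut.one_apply]
    rw [map_mul, MulAut.mul_apply]
    exact this.trans (congrArg χ hr)
  have hspan : Submodule.span k (Set.range x) = ⊤ := by
    let W : Subrepresentation ρ := ⟨Submodule.span k (Set.range x), fun g y hy ↦ by
      refine Submodule.span_induction ?_ ?_ ?_ ?_ hy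
      · rintro _ ⟨q, rfl⟩
        obtain ⟨a, ha⟩ := hHw _ (QuotientGroup.eq.mp
          (Quotient.out_eq' ((g * q.out : G) : G ⧸ H)))
        have : ρ g (x q) = a • x ((g * q.out : G) : G ⧸ H) := by
          simp only [x]
          rw [← map_smul, ← ha, ← Module.End.mul_apply, ← Module.End.mul_apply, ← map_mul,
            ← map_mul, mul_inv_cancel_left]
        rw [this]
        exact Submodule.smul_mem _ _ (Submodule.subset_span ⟨_, rfl⟩)
      · simp
      · intro y z _ _ hy hz
        rw [map_add]
        exact Submodule.add_mem _ hy hz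
      · intro a y _ hy
        rw [map_smul]
        exact Submodule.smul_mem _ _ hy⟩
    have hW : W ≠ ⊥ := fun hbot ↦ hx0 ((1 : G) : G ⧸ H) <| by
      have hmem : x ((1 : G) : G ⧸ H) ∈ W := Submodule.subset_span ⟨_, rfl⟩
      rw [hbot] at hmem
      exact hmem
    exact congrArg Subrepresentation.toSubmodule ((eq_bot_or_eq_top W).resolve_left hW)
  have := Fintype.ofFinite (G ⧸ H)
  rw [Module.finrank_eq_card_basis (Basis.mk hli hspan.ge), ← Nat.card_eq_fintype_card]
  rfl

end Representation

open scoped MonoidAlgebra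

/-- The representation afforded by a simple module over the group algebra is irreducible. -/
theorem Representation.isIrreducible_ofModule' {k G M : Type*} [Field k] [Group G]
    [AddCommGroup M] [Module k M] [Module k[G] M] [IsScalarTower k k[G] M]
    [IsSimpleModule k[G] M] :
    (Representation.ofModule' (k := k) (G := G) M).IsIrreducible := by
  have := IsSimpleModule.nontrivial k[G] M
  have : Nontrivial (Subrepresentation (Representation.ofModule' (k := k) (G := G) M)) :=
    ⟨⟨⊥, ⊤, fun h ↦ bot_ne_top (α := Submodule k M)
      (congrArg Subrepresentation.toSubmodule h)⟩⟩
  refine ⟨fun W ↦ ?_⟩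
  let W' : Submodule k[G] M :=
    { W.toSubmodule with
      smul_mem' := fun r x hx ↦ by
        induction r using MonoidAlgebra.induction_on with
        | of g => simpa [Representation.ofModule'] using W.apply_mem_toSubmodule g hx
        | add a b ha hb =>
          rw [add_smul]
          exact W.toSubmodule.add_mem ha hb
        | smul c a ha =>
          rw [smul_assoc]
          exact W.toSubmodule.smul_mem c ha }
  refine (eq_bot_or_eq_top W').imp (fun h ↦ ?_) (fun h ↦ ?_) <;>
  · refine Subrepresentation.toSubmodule_injective (Submodule.ext fun x ↦ ?_)
    exact (Submodule.ext_iff.mp h) x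

/-- Every linear character of a subgroup occurs in the restriction of some simple
representation. -/
theorem FDRep.exists_simple_weight {k : Type} {G : Type} [Field k] [IsAlgClosed k] [CharZero k]
    [Group G] [Finite G] (N : Subgroup G) (χ : N →* k) :
    ∃ (V : FDRep k G) (v : V), Simple V ∧ v ≠ 0 ∧ ∀ n : N, V.ρ n v = χ n • v := by
  classical
  have := Fintype.ofFinite N
  let e : k[G] := ∑ n : N, MonoidAlgebra.single (n : G) (χ n⁻¹)
  have he : ∀ n : N, MonoidAlgebra.of k G n * e = χ n • e := by
    intro n
    simp only [e, Finset.mul_sum, Finset.smul_sum, MonoidAlgebra.of_apply,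
      MonoidAlgebra.single_mul_single, one_mul]
    refine Fintype.sum_equiv (Equiv.mulLeft n) _ _ fun m ↦ ?_
    rw [MonoidAlgebra.smul_single, smul_eq_mul, mul_comm, ← map_mul]
    congr 2
    simp
  have he0 : e ≠ 0 := by
    intro h0
    have := congrArg (fun f : k[G] ↦ f.coeff 1) h0
    simp only [e, MonoidAlgebra.coeff_sum, MonoidAlgebra.coeff_single, Finsupp.finsetSum_apply,
      Finsupp.single_apply, OneMemClass.coe_eq_one, Finset.sum_ite_eq', Finset.mem_univ] at this
    simp at this
  let M := Submodule.span k[G] {e}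
  let e' : M := ⟨e, Submodule.mem_span_singleton_self e⟩
  have : Nontrivial M := ⟨⟨e', 0, fun h ↦ he0 (congrArg Subtype.val h)⟩⟩
  obtain ⟨J, hJ⟩ := IsCoatomic.exists_coatom (Submodule k[G] M)
  have hsimple : IsSimpleModule k[G] (M ⧸ J) := isSimpleModule_iff_isCoatom.mpr hJ
  have := Representation.isIrreducible_ofModule' (k := k) (G := G) (M := M ⧸ J)
  have : Module.Finite k (M ⧸ J) := Module.Finite.trans k[G] _
  refine ⟨FDRep.of (Representation.ofModule' (M ⧸ J)), J.mkQ e',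
    FDRep.simple_of_isIrreducible _, fun h0 ↦ hJ.1 ?_, fun n ↦ ?_⟩
  · have heJ : e' ∈ J := (Submodule.Quotient.mk_eq_zero J).mp h0
    refine (Submodule.eq_top_iff').mpr fun x ↦ ?_
    obtain ⟨r, hr⟩ := Submodule.mem_span_singleton.mp x.2
    have hx : x = r • e' := Subtype.ext hr.symm
    exact hx ▸ J.smul_mem r heJ
  · have hn : MonoidAlgebra.of k G n • e' = χ n • e' := Subtype.ext (he n)
    exact congrArg J.mkQ hn

namespace Representation

variable {k G V : Type*} [Field k] [Group G] [AddCommGroup V] [Module k V]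

/-- The stabilizer of a linear character of a normal subgroup. -/
def weightStabilizer {N : Subgroup G} [N.Normal] (χ : N →* k) : Subgroup G where
  carrier := {g | ∀ n : N, χ (MulAut.conjNormal g n) = χ n}
  one_mem' n := by simp
  mul_mem' {a b} ha hb n := by rw [map_mul, MulAut.mul_apply, ha, hb]
  inv_mem' {a} ha n := by
    rw [← ha, ← MulAut.mul_apply, ← map_mul, mul_inv_cancel, map_one, MulAut.one_apply]

theorem mem_weightStabilizer {N : Subgroup G} [N.Normal] {χ : N →* k} {g : G} :
    g ∈ weightStabilizer χ ↔ ∀ n : N, χ (MulAut.conjNormal g n) = χ n := Iff.rfl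

theorem le_weightStabilizer {N : Subgroup G} [N.Normal] (χ : N →* k) :
    N ≤ weightStabilizer χ := by
  intro g hg n
  have : MulAut.conjNormal g n = ⟨g, hg⟩ * n * ⟨g, hg⟩⁻¹ := Subtype.ext (by simp)
  rw [this, map_mul, map_mul, mul_right_comm, ← map_mul, mul_inv_cancel, map_one, one_mul]

/-- If `G ⧸ N` is cyclic, the degree of an irreducible representation lying over a linear
character of `N` is the index of the stabilizer of this character. -/
theorem finrank_eq_index_weightStabilizer [IsAlgClosed k] [FiniteDimensional k V] [Finite G]
    (ρ : Representation k G V) [ρ.IsIrreducible] {N : Subgroup G} [N.Normal] [IsCyclic (G ⧸ N)]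
    (χ : N →* k) {v : V} (hv : v ≠ 0) (hχ : ∀ n : N, ρ n v = χ n • v) :
    finrank k V = (weightStabilizer χ).index := by
  let π := QuotientGroup.mk' N
  obtain ⟨⟨_, h, hh, rfl⟩, hgen⟩ :=
    IsCyclic.exists_monoid_generator (α := (weightStabilizer χ).map π)
  refine finrank_eq_index_of_weight ρ χ hv hχ (fun g ↦ mem_weightStabilizer) hh fun g hg ↦ ?_
  obtain ⟨m, hm⟩ := hgen ⟨π g, g, hg, rfl⟩
  have hpow : π h ^ m = π g := congrArg Subtype.val hm
  refine ⟨g * (h ^ m)⁻¹, ?_, m, by group⟩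
  rw [← QuotientGroup.ker_mk' N, MonoidHom.mem_ker, map_mul, map_inv, map_pow]
  exact mul_inv_eq_one.mpr hpow.symm

/-- In an irreducible representation, a central element with a nonzero fixed vector acts
trivially. -/
theorem apply_eq_one_of_mem_center (ρ : Representation k G V) [ρ.IsIrreducible] {z : G}
    (hz : z ∈ Subgroup.center G) {v : V} (hv : v ≠ 0) (hzv : ρ z v = v) : ρ z = 1 := by
  let W : Subrepresentation ρ := ⟨Module.End.eigenspace (ρ z) 1, fun g w hw ↦ by
    rw [Module.End.mem_eigenspace_iff, one_smul] at hw ⊢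
    rw [← Module.End.mul_apply, ← map_mul, ← Subgroup.mem_center_iff.mp hz, map_mul,
      Module.End.mul_apply, hw]⟩
  have hvW : v ∈ W.toSubmodule := Module.End.mem_eigenspace_iff.mpr (by rw [hzv, one_smul])
  have hW : W ≠ ⊥ := fun h ↦ hv <| by
    rw [h] at hvW
    exact hvW
  have htop : W.toSubmodule = ⊤ :=
    congrArg Subrepresentation.toSubmodule ((eq_bot_or_eq_top W).resolve_left hW)
  ext x
  have hx : x ∈ W.toSubmodule := htop ▸ Submodule.mem_top
  simpa using Module.End.mem_eigenspace_iff.mp hx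

theorem nontrivial_of_isIrreducible (ρ : Representation k G V) [ρ.IsIrreducible] :
    Nontrivial V := by
  by_contra h
  rw [not_nontrivial_iff_subsingleton] at h
  exact bot_ne_top (α := Subrepresentation ρ) <|
    Subrepresentation.toSubmodule_injective (Subsingleton.elim _ _)

end Representation

open scoped commutatorElement

/-- The Heisenberg group of the symplectic space `(ZMod 3)⁴`, with coordinates `(x, y)` on the
symplectic space and central coordinate `z`. -/
@[ext]
structure Heis where
  /-- first coordinate of the first Lagrangian -/
  x₁ : ZMod 3
  /-- second coordinate of the first Lagrangian -/
  x₂ : ZMod 3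
  /-- first coordinate of the second Lagrangian -/
  y₁ : ZMod 3
  /-- second coordinate of the second Lagrangian -/
  y₂ : ZMod 3
  /-- central coordinate -/
  z : ZMod 3

namespace Heis

instance : Mul Heis where
  mul a b := ⟨a.x₁ + b.x₁, a.x₂ + b.x₂, a.y₁ + b.y₁, a.y₂ + b.y₂,
    a.z + b.z + (a.x₁ * b.y₁ + a.x₂ * b.y₂ - a.y₁ * b.x₁ - a.y₂ * b.x₂)⟩

instance : One Heis where one := ⟨0, 0, 0, 0, 0⟩

instance : Inv Heis where inv a := ⟨-a.x₁, -a.x₂, -a.y₁, -a.y₂, -a.z⟩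

@[simp] theorem x₁_mul (a b : Heis) : (a * b).x₁ = a.x₁ + b.x₁ := rfl
@[simp] theorem x₂_mul (a b : Heis) : (a * b).x₂ = a.x₂ + b.x₂ := rfl
@[simp] theorem y₁_mul (a b : Heis) : (a * b).y₁ = a.y₁ + b.y₁ := rfl
@[simp] theorem y₂_mul (a b : Heis) : (a * b).y₂ = a.y₂ + b.y₂ := rfl
@[simp] theorem z_mul (a b : Heis) : (a * b).z =
    a.z + b.z + (a.x₁ * b.y₁ + a.x₂ * b.y₂ - a.y₁ * b.x₁ - a.y₂ * b.x₂) := rfl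
@[simp] theorem x₁_one : (1 : Heis).x₁ = 0 := rfl
@[simp] theorem x₂_one : (1 : Heis).x₂ = 0 := rfl
@[simp] theorem y₁_one : (1 : Heis).y₁ = 0 := rfl
@[simp] theorem y₂_one : (1 : Heis).y₂ = 0 := rfl
@[simp] theorem z_one : (1 : Heis).z = 0 := rfl
@[simp] theorem x₁_inv (a : Heis) : a⁻¹.x₁ = -a.x₁ := rfl
@[simp] theorem x₂_inv (a : Heis) : a⁻¹.x₂ = -a.x₂ := rfl
@[simp] theorem y₁_inv (a : Heis) : a⁻¹.y₁ = -a.y₁ := rfl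
@[simp] theorem y₂_inv (a : Heis) : a⁻¹.y₂ = -a.y₂ := rfl
@[simp] theorem z_inv (a : Heis) : a⁻¹.z = -a.z := rfl

instance : Group Heis :=
  Group.ofLeftAxioms (fun a b c ↦ by ext <;> simp <;> ring) (fun a ↦ by ext <;> simp)
    (fun a ↦ by ext <;> simp; ring)

/-- The coordinates of an element of the Heisenberg group. -/
def equivProd : Heis ≃ ZMod 3 × ZMod 3 × ZMod 3 × ZMod 3 × ZMod 3 where
  toFun a := (a.x₁, a.x₂, a.y₁, a.y₂, a.z)
  invFun p := ⟨p.1, p.2.1, p.2.2.1, p.2.2.2.1, p.2.2.2.2⟩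

instance : Finite Heis := Finite.of_equiv _ equivProd.symm

theorem card : Nat.card Heis = 3 ^ 5 := by
  rw [Nat.card_congr equivProd]
  simp

theorem pow_three (a : Heis) : a ^ 3 = 1 := by
  have h3 : (3 : ZMod 3) = 0 := rfl
  rw [pow_succ, pow_two]
  ext <;> simp <;> ring_nf <;> simp [h3]

/-- The elements of the center. -/
def ofZ (t : ZMod 3) : Heis := ⟨0, 0, 0, 0, t⟩

theorem mul_ofZ (a : Heis) (t : ZMod 3) :
    a * ofZ t = ⟨a.x₁, a.x₂, a.y₁, a.y₂, a.z + t⟩ := by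
  ext <;> simp [ofZ]

theorem commutatorElement_eq (a b : Heis) :
    ⁅a, b⁆ = ofZ (-(a.x₁ * b.y₁ + a.x₂ * b.y₂ - a.y₁ * b.x₁ - a.y₂ * b.x₂)) := by
  have h3 : (3 : ZMod 3) = 0 := rfl
  ext <;> simp [commutatorElement_def, ofZ]
  linear_combination (a.x₁ * b.y₁ + a.x₂ * b.y₂ - a.y₁ * b.x₁ - a.y₂ * b.x₂) * h3

theorem mem_center_iff (a : Heis) :
    a ∈ Subgroup.center Heis ↔ a.x₁ = 0 ∧ a.x₂ = 0 ∧ a.y₁ = 0 ∧ a.y₂ = 0 := by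
  have key : ∀ b, b * a = a * b ↔
      b.x₁ * a.y₁ + b.x₂ * a.y₂ - b.y₁ * a.x₁ - b.y₂ * a.x₂ = 0 := by
    intro b
    rw [← commutatorElement_eq_one_iff_mul_comm, commutatorElement_eq]
    simp only [ofZ, Heis.ext_iff, x₁_one, x₂_one, y₁_one, y₂_one, z_one, true_and, neg_eq_zero]
  rw [Subgroup.mem_center_iff]
  simp only [key]
  constructor
  · intro h
    refine ⟨?_, ?_, ?_, ?_⟩
    · simpa using h ⟨0, 0, 1, 0, 0⟩
    · simpa using h ⟨0, 0, 0, 1, 0⟩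
    · simpa using h ⟨1, 0, 0, 0, 0⟩
    · simpa using h ⟨0, 1, 0, 0, 0⟩
  · rintro ⟨h₁, h₂, h₃, h₄⟩ b
    simp [h₁, h₂, h₃, h₄]

theorem ofZ_mem_center (t : ZMod 3) : ofZ t ∈ Subgroup.center Heis :=
  (mem_center_iff _).mpr ⟨rfl, rfl, rfl, rfl⟩

theorem exists_ofZ_of_mem_center {a : Heis} (ha : a ∈ Subgroup.center Heis) : ∃ t, a = ofZ t := by
  obtain ⟨h₁, h₂, h₃, h₄⟩ := (mem_center_iff a).mp ha
  exact ⟨a.z, by ext <;> simp [ofZ, *]⟩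

theorem card_center : Nat.card (Subgroup.center Heis) = 3 := by
  rw [← Nat.card_zmod 3]
  refine (Nat.card_eq_of_bijective
    (fun t : ZMod 3 ↦ (⟨ofZ t, ofZ_mem_center t⟩ : Subgroup.center Heis)) ⟨?_, ?_⟩).symm
  · intro s t h
    exact congrArg (fun a : Subgroup.center Heis ↦ (a : Heis).z) h
  · rintro ⟨a, ha⟩
    obtain ⟨t, rfl⟩ := exists_ofZ_of_mem_center ha
    exact ⟨t, rfl⟩

theorem center_eq_commutator : Subgroup.center Heis = commutator Heis := by
  apply le_antisymm
  · intro a ha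
    obtain ⟨t, rfl⟩ := exists_ofZ_of_mem_center ha
    have : ofZ t = ⁅(⟨t, 0, 0, 0, 0⟩ : Heis), ⟨0, 0, -1, 0, 0⟩⁆ := by
      simp [commutatorElement_eq]
    rw [this]
    exact Subgroup.commutator_mem_commutator (Subgroup.mem_top _) (Subgroup.mem_top _)
  · refine Subgroup.commutator_le.mpr fun a _ b _ ↦ ?_
    rw [commutatorElement_eq]
    exact ofZ_mem_center _

end Heis

/-- The kernel of a surjection onto a commutative group of prime order is a maximal subgroup. -/
theorem MonoidHom.isCoatom_ker_of_prime_card {G H : Type*} [Group G] [CommGroup H] {p : ℕ}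
    (hp : p.Prime) (hH : Nat.card H = p) (f : G →* H) (hf : Function.Surjective f) :
    IsCoatom f.ker := by
  have := Fact.mk hp
  have : IsSimpleGroup H := isSimpleGroup_of_prime_card hH
  rw [← MonoidHom.comap_bot]
  exact Subgroup.isCoatom_comap_of_surjective hf isCoatom_bot

/-- If the center equals the derived subgroup, it lies in the Frattini subgroup. -/
theorem center_le_frattini_of_center_eq_commutator {G : Type*} [Group G]
    (h : Subgroup.center G = commutator G) : Subgroup.center G ≤ frattini G := by
  refine le_iInf₂ fun M hM ↦ ?_
  by_contra hZ
  have htop : M ⊔ Subgroup.center G = ⊤ := hM.2 _ (left_lt_sup.mpr hZ)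
  have hdec : ∀ g, ∃ m ∈ M, ∃ c ∈ Subgroup.center G, m * c = g := fun g ↦
    Subgroup.mem_sup_of_normal_right.mp (htop ▸ Subgroup.mem_top g)
  refine hZ (h ▸ Subgroup.commutator_le.mpr fun a _ b _ ↦ ?_)
  obtain ⟨m, hm, c, hc, rfl⟩ := hdec a
  obtain ⟨n, hn, d, hd, rfl⟩ := hdec b
  have : ⁅m * c, n * d⁆ = ⁅m, n⁆ := by
    have h₁ : c * (n * d) * c⁻¹ = n * d := by
      rw [← Subgroup.mem_center_iff.mp hc, mul_inv_cancel_right]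
    have h₂ : d * m⁻¹ * d⁻¹ = m⁻¹ := by
      rw [← Subgroup.mem_center_iff.mp hd, mul_inv_cancel_right]
    calc m * c * (n * d) * (m * c)⁻¹ * (n * d)⁻¹
        = m * (c * (n * d) * c⁻¹) * m⁻¹ * (d⁻¹ * n⁻¹) := by group
      _ = m * n * (d * m⁻¹ * d⁻¹) * n⁻¹ := by rw [h₁]; group
      _ = m * n * m⁻¹ * n⁻¹ := by rw [h₂]
  rw [this, commutatorElement_def]
  exact M.mul_mem (M.mul_mem (M.mul_mem hm hn) (M.inv_mem hm)) (M.inv_mem hn)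

/-- Being extraspecial is invariant under isomorphism. -/
theorem IsExtraspecial.of_mulEquiv {p : ℕ} {G H : Type*} [Group G] [Group H]
    (h : IsExtraspecial p G) (e : G ≃* H) : IsExtraspecial p H := by
  obtain ⟨h₁, h₂, h₃, h₄⟩ := h
  have hc : Subgroup.center H = (Subgroup.center G).map e.toMonoidHom := by
    ext x
    obtain ⟨g, rfl⟩ := e.surjective x
    have : (e g ∈ (Subgroup.center G).map e.toMonoidHom) ↔ g ∈ Subgroup.center G :=
      Subgroup.mem_map_iff_mem e.injective
    rw [this, Subgroup.mem_center_iff, Subgroup.mem_center_iff, e.surjective.forall]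
    simp only [← map_mul, e.injective.eq_iff]
  have hd : commutator H = (commutator G).map e.toMonoidHom := by
    rw [commutator_def, commutator_def, Subgroup.map_commutator,
      Subgroup.map_top_of_surjective _ e.surjective]
  have hf : frattini H = (frattini G).map e.toMonoidHom :=
    (e.mapSubgroup.map_radical).symm
  refine ⟨h₁.of_equiv e, by rw [hc, hd, h₂], by rw [hd, hf, h₃], ?_⟩
  rw [hc, ← h₄]
  exact Nat.card_congr ((Subgroup.center G).equivMapOfInjective _ e.injective).toEquiv.symm

namespace Heis

theorem isExtraspecial : IsExtraspecial 3 Heis := by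
  refine ⟨IsPGroup.of_card card, center_eq_commutator, le_antisymm ?_ ?_, card_center⟩
  · rw [← center_eq_commutator]
    exact center_le_frattini_of_center_eq_commutator center_eq_commutator
  · rw [← center_eq_commutator]
    have key : ∀ f : Heis → ZMod 3, (hf : ∀ a b, f (a * b) = f a + f b) → f 1 = 0 →
        Function.Surjective f → ∀ a ∈ frattini Heis, f a = 0 := by
      intro f hf h1 hsurj a ha
      let F : Heis →* Multiplicative (ZMod 3) :=
        ⟨⟨fun a ↦ Multiplicative.ofAdd (f a), by simp [h1]⟩, fun a b ↦ by simp [hf]⟩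
      have := F.isCoatom_ker_of_prime_card Nat.prime_three (by simp) hsurj
      exact frattini_le_coatom this ha
    intro a ha
    refine (mem_center_iff a).mpr ⟨key _ x₁_mul rfl (fun t ↦ ⟨⟨t, 0, 0, 0, 0⟩, rfl⟩) a ha,
      key _ x₂_mul rfl (fun t ↦ ⟨⟨0, t, 0, 0, 0⟩, rfl⟩) a ha,
      key _ y₁_mul rfl (fun t ↦ ⟨⟨0, 0, t, 0, 0⟩, rfl⟩) a ha,
      key _ y₂_mul rfl (fun t ↦ ⟨⟨0, 0, 0, t, 0⟩, rfl⟩) a ha⟩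

theorem ofZ_pow (t : ZMod 3) (n : ℕ) : ofZ t ^ n = ofZ (n * t) := by
  induction n with
  | zero => ext <;> simp [ofZ]
  | succ n ih =>
    rw [pow_succ, ih, mul_ofZ]
    ext <;> simp [ofZ]
    ring

/-- The automorphism of the Heisenberg group induced by a regular unipotent symplectic
transformation. -/
def shear : MulAut Heis where
  toFun a := ⟨a.x₁ + a.x₂ + a.y₂, a.x₂ + a.y₂, a.y₁, a.y₂ - a.y₁, a.z⟩
  invFun a := ⟨a.x₁ - a.x₂, a.x₂ - a.y₂ - a.y₁, a.y₁, a.y₂ + a.y₁, a.z⟩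
  left_inv a := by ext <;> simp; ring
  right_inv a := by ext <;> simp; ring
  map_mul' a b := by ext <;> simp <;> ring

theorem shear_apply (a : Heis) :
    shear a = ⟨a.x₁ + a.x₂ + a.y₂, a.x₂ + a.y₂, a.y₁, a.y₂ - a.y₁, a.z⟩ := rfl

theorem shear_pow_three_apply (a : Heis) :
    (shear ^ 3) a = ⟨a.x₁ - a.y₁, a.x₂, a.y₁, a.y₂, a.z⟩ := by
  have h3 : (3 : ZMod 3) = 0 := rfl
  rw [pow_succ, pow_two, MulAut.mul_apply, MulAut.mul_apply]
  ext <;> simp only [shear_apply]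
  · linear_combination (a.x₂ + 2 * a.y₂ - a.y₁) * h3
  · linear_combination (a.y₂ - a.y₁) * h3
  · linear_combination (- a.y₁) * h3

theorem orderOf_shear : orderOf shear = 9 := by
  have h3 : (3 : ZMod 3) = 0 := rfl
  refine orderOf_eq_prime_pow (p := 3) (n := 1) (fun h ↦ ?_) ?_
  · have := congrArg Heis.x₁ (DFunLike.congr_fun h ⟨0, 0, 1, 0, 0⟩)
    rw [pow_one, shear_pow_three_apply] at this
    exact absurd this (by decide)
  · ext a : 1
    change (shear ^ (3 * 3)) a = a
    rw [pow_mul, pow_succ, pow_two, MulAut.mul_apply, MulAut.mul_apply]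
    ext <;> simp only [shear_pow_three_apply]
    linear_combination (- a.y₁) * h3

/-- The elements of the Heisenberg group lying over the first Lagrangian. -/
def ofX (x₁ x₂ z : ZMod 3) : Heis := ⟨x₁, x₂, 0, 0, z⟩

theorem exists_apply_ofX {f : MulAut Heis} (hf : f ∈ Subgroup.zpowers shear) (x₁ x₂ : ZMod 3) :
    ∃ x₁' x₂', ∀ z, f (ofX x₁ x₂ z) = ofX x₁' x₂' z := by
  rw [← mem_powers_iff_mem_zpowers] at hf
  obtain ⟨n, rfl⟩ := hf
  induction n with
  | zero => exact ⟨x₁, x₂, fun z ↦ rfl⟩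
  | succ n ih =>
    obtain ⟨x₁', x₂', h⟩ := ih
    refine ⟨x₁' + x₂', x₂', fun z ↦ ?_⟩
    simp only at h ⊢
    rw [pow_succ', MulAut.mul_apply, h, shear_apply]
    simp [ofX]

theorem conj_ofX (a : Heis) (x₁ x₂ z : ZMod 3) :
    a * ofX x₁ x₂ z * a⁻¹ = ofX x₁ x₂ (z + (a.y₁ * x₁ + a.y₂ * x₂)) := by
  have h3 : (3 : ZMod 3) = 0 := rfl
  ext <;> simp [ofX]
  linear_combination (- (a.y₁ * x₁ + a.y₂ * x₂)) * h3

theorem ofX_mul (x₁ x₂ z x₁' x₂' z' : ZMod 3) :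
    ofX x₁ x₂ z * ofX x₁' x₂' z' = ofX (x₁ + x₁') (x₂ + x₂') (z + z') := by
  ext <;> simp [ofX]

theorem y_apply_eq_zero {f : MulAut Heis} (hf : f ∈ Subgroup.zpowers shear) {a : Heis}
    (h₁ : a.y₁ = 0) (h₂ : a.y₂ = 0) : (f a).y₁ = 0 ∧ (f a).y₂ = 0 := by
  obtain ⟨x₁', x₂', h⟩ := exists_apply_ofX hf a.x₁ a.x₂
  have : a = ofX a.x₁ a.x₂ a.z := by ext <;> simp [ofX, h₁, h₂]
  rw [this, h]
  exact ⟨rfl, rfl⟩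

end Heis

open Heis SemidirectProduct

/-- The extension of the Heisenberg group by the cyclic group of order `9` generated by
`Heis.shear`. -/
abbrev HeisShear : Type := Heis ⋊[(Subgroup.zpowers shear).subtype] Subgroup.zpowers shear

namespace HeisShear

theorem card_zpowers_shear : Nat.card (Subgroup.zpowers shear) = 9 := by
  rw [Nat.card_zpowers, orderOf_shear]

instance : Finite HeisShear := Finite.of_equiv _ SemidirectProduct.equivProd.symm

theorem card : Nat.card HeisShear = 3 ^ 7 := by
  rw [SemidirectProduct.card, Heis.card, card_zpowers_shear]
  norm_num

/-- The Heisenberg group as a normal subgroup. -/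
abbrev base : Subgroup HeisShear := (rightHom : HeisShear →* _).ker

/-- The isomorphism of the Heisenberg group with its image. -/
noncomputable def baseEquiv : Heis ≃* base :=
  (MonoidHom.ofInjective inl_injective).trans
    (MulEquiv.subgroupCongr range_inl_eq_ker_rightHom)

theorem coe_baseEquiv (a : Heis) : (baseEquiv a : HeisShear) = inl a := rfl

theorem card_base : Nat.card base = 3 ^ 5 := by
  rw [← Nat.card_congr baseEquiv.toEquiv, Heis.card]

theorem isCyclic_quotient_base : IsCyclic (HeisShear ⧸ base) :=
  isCyclic_of_surjective _
    (QuotientGroup.quotientKerEquivOfSurjective _ rightHom_surjective).symm.surjective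

theorem index_base : base.index = 9 := by
  rw [Subgroup.index_ker, MonoidHom.range_eq_top.mpr rightHom_surjective, Subgroup.card_top,
    card_zpowers_shear]

theorem pow_three_of_mem_base (g : HeisShear) (hg : g ∈ base) : g ^ 3 = 1 := by
  obtain ⟨a, ha⟩ := baseEquiv.surjective ⟨g, hg⟩
  have : inl a = g := congrArg Subtype.val ha
  rw [← this, ← map_pow, Heis.pow_three, map_one]

/-- The generator of the complement. -/
def gen : HeisShear := inr ⟨shear, Subgroup.mem_zpowers _⟩

theorem exists_inr_eq_gen_pow (q : Subgroup.zpowers shear) : ∃ m : ℕ, inr q = gen ^ m := by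
  obtain ⟨f, hf⟩ := q
  obtain ⟨m, rfl⟩ := mem_powers_iff_mem_zpowers.mpr hf
  exact ⟨m, by rw [gen, ← map_pow]; rfl⟩

theorem gen_mul_inl_mul_inv (a : Heis) : gen * inl a * gen⁻¹ = inl (shear a) := by
  rw [gen, ← map_inv, ← inl_aut]
  rfl

theorem commutator_gen_inl (a : Heis) : ⁅gen, (inl a : HeisShear)⁆ = inl (shear a * a⁻¹) := by
  rw [commutatorElement_def, gen_mul_inl_mul_inv, map_mul, map_inv]

theorem inl_ofZ_mem_center (t : ZMod 3) :
    (inl (ofZ t) : HeisShear) ∈ Subgroup.center HeisShear := by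
  rw [Subgroup.mem_center_iff]
  intro g
  obtain ⟨m, hm⟩ := exists_inr_eq_gen_pow g.right
  have hgen : Commute gen (inl (ofZ t)) := by
    rw [← commutatorElement_eq_one_iff_commute, commutator_gen_inl]
    have : shear (ofZ t) = ofZ t := by ext <;> simp [shear_apply, ofZ]
    rw [this, mul_inv_cancel, map_one]
  have hleft : Commute (inl g.left : HeisShear) (inl (ofZ t)) :=
    (show Commute g.left (ofZ t) from Subgroup.mem_center_iff.mp (ofZ_mem_center t) _).map inl
  rw [← inl_left_mul_inr_right g, hm]
  exact hleft.mul_left (hgen.pow_left m)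

theorem derivedSeries_two_ne_bot : derivedSeries HeisShear 2 ≠ ⊥ := by
  intro h
  let a : HeisShear := ⁅gen, inl ⟨0, 0, 1, 0, 0⟩⁆
  let b : HeisShear := ⁅gen, inl ⟨0, 0, 0, 1, 0⟩⁆
  have hmem : ∀ c d : HeisShear, ⁅c, d⁆ ∈ derivedSeries HeisShear 1 := fun c d ↦
    Subgroup.commutator_mem_commutator (Subgroup.mem_top _) (Subgroup.mem_top _)
  have hab : ⁅a, b⁆ ∈ derivedSeries HeisShear 2 :=
    Subgroup.commutator_mem_commutator (hmem _ _) (hmem _ _)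
  rw [h, Subgroup.mem_bot] at hab
  simp only [a, b, commutator_gen_inl, ← map_commutatorElement, commutatorElement_eq] at hab
  rw [← map_one (inl : Heis →* HeisShear), inl_inj] at hab
  exact absurd (congrArg Heis.z hab) (by decide)

theorem derivedSeries_three_eq_bot : derivedSeries HeisShear 3 = ⊥ := by
  have h₁ : derivedSeries HeisShear 1 ≤ base := by
    refine Subgroup.commutator_le.mpr fun a _ b _ ↦ ?_
    rw [MonoidHom.mem_ker, map_commutatorElement]
    exact commutatorElement_eq_one_iff_mul_comm.mpr (mul_comm' _ _)
  have h₂ : derivedSeries HeisShear 2 ≤ Subgroup.center HeisShear := by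
    refine Subgroup.commutator_le.mpr fun a ha b hb ↦ ?_
    obtain ⟨a', ha'⟩ := baseEquiv.surjective ⟨a, h₁ ha⟩
    obtain ⟨b', hb'⟩ := baseEquiv.surjective ⟨b, h₁ hb⟩
    have ha'' : inl a' = a := congrArg Subtype.val ha'
    have hb'' : inl b' = b := congrArg Subtype.val hb'
    rw [← ha'', ← hb'', ← map_commutatorElement, commutatorElement_eq]
    exact inl_ofZ_mem_center _
  refine (Subgroup.eq_bot_iff_forall _).mpr fun x hx ↦ ?_
  refine (Subgroup.mem_bot).mp (Subgroup.commutator_le.mpr (fun a ha b hb ↦ ?_) hx)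
  rw [Subgroup.mem_bot, commutatorElement_eq_one_iff_mul_comm]
  exact Subgroup.mem_center_iff.mp (h₂ hb) a

theorem conj_inl (g : HeisShear) (a : Heis) :
    g * inl a * g⁻¹ = inl (g.left * (g.right : MulAut Heis) a * g.left⁻¹) := by
  conv_lhs => rw [← inl_left_mul_inr_right g]
  have h := inl_aut (φ := (Subgroup.zpowers shear).subtype) g.right a
  rw [map_inv] at h
  rw [map_mul, map_mul, map_inv, ← Subgroup.subtype_apply, h]
  group

theorem exists_conj_inl_ofX (g : HeisShear) (x₁ x₂ : ZMod 3) :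
    ∃ x₁' x₂', ∀ z, g * inl (ofX x₁ x₂ z) * g⁻¹ =
      inl (ofX x₁' x₂' (z + (g.left.y₁ * x₁' + g.left.y₂ * x₂'))) := by
  obtain ⟨x₁', x₂', h⟩ := exists_apply_ofX g.right.2 x₁ x₂
  exact ⟨x₁', x₂', fun z ↦ by rw [conj_inl, h, conj_ofX]⟩

theorem exists_conj_inl_ofX_eq (g : HeisShear) (x₁ x₂ : ZMod 3) :
    ∃ x₁' x₂', ∀ z, g * inl (ofX x₁' x₂' z) * g⁻¹ =
      inl (ofX x₁ x₂ (z + (g.left.y₁ * x₁ + g.left.y₂ * x₂))) := by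
  obtain ⟨x₁', x₂', h⟩ := exists_apply_ofX (inv_mem g.right.2) x₁ x₂
  refine ⟨x₁', x₂', fun z ↦ ?_⟩
  rw [conj_inl, ← h, MulAut.apply_inv_self, conj_ofX]

/-- The abelian normal subgroup lying over the first Lagrangian. -/
def lagrangian : Subgroup HeisShear where
  carrier := {g | ∃ x₁ x₂ z, inl (ofX x₁ x₂ z) = g}
  one_mem' := ⟨0, 0, 0, rfl⟩
  mul_mem' := by
    rintro _ _ ⟨x₁, x₂, z, rfl⟩ ⟨x₁', x₂', z', rfl⟩
    exact ⟨_, _, _, by rw [← map_mul, ofX_mul]⟩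
  inv_mem' := by
    rintro _ ⟨x₁, x₂, z, rfl⟩
    exact ⟨-x₁, -x₂, -z, by rw [← map_inv]; congr 1; ext <;> simp [ofX]⟩

instance : lagrangian.Normal where
  conj_mem := by
    rintro _ ⟨x₁, x₂, z, rfl⟩ g
    obtain ⟨x₁', x₂', h⟩ := exists_conj_inl_ofX g x₁ x₂
    exact ⟨_, _, _, (h z).symm⟩

/-- The elements of the subgroup lying over the first Lagrangian. -/
def mkX (x₁ x₂ z : ZMod 3) : lagrangian := ⟨inl (ofX x₁ x₂ z), x₁, x₂, z, rfl⟩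

theorem mkX_mul (x₁ x₂ z x₁' x₂' z' : ZMod 3) :
    mkX x₁ x₂ z * mkX x₁' x₂' z' = mkX (x₁ + x₁') (x₂ + x₂') (z + z') :=
  Subtype.ext <| by rw [Subgroup.coe_mul, mkX, mkX, ← map_mul, ofX_mul]; rfl

theorem mkX_pow (x₁ x₂ z : ZMod 3) (n : ℕ) :
    mkX x₁ x₂ z ^ n = mkX (n * x₁) (n * x₂) (n * z) := by
  induction n with
  | zero => simp only [pow_zero, Nat.cast_zero, zero_mul]; rfl
  | succ n ih => rw [pow_succ, ih, mkX_mul]; congr 1 <;> push_cast <;> ring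

theorem exists_mkX_eq (a : lagrangian) : ∃ x₁ x₂ z, mkX x₁ x₂ z = a := by
  obtain ⟨_, x₁, x₂, z, rfl⟩ := a
  exact ⟨x₁, x₂, z, rfl⟩

theorem lagrangian_commute (a b : lagrangian) : Commute a b := by
  obtain ⟨x₁, x₂, z, rfl⟩ := exists_mkX_eq a
  obtain ⟨x₁', x₂', z', rfl⟩ := exists_mkX_eq b
  rw [Commute, SemiconjBy, mkX_mul, mkX_mul, add_comm x₁, add_comm x₂, add_comm z]

/-- The stabilizer of the standard characters of `lagrangian`: the elements without second
Lagrangian part. -/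
def polarization : Subgroup HeisShear where
  carrier := {g | g.left.y₁ = 0 ∧ g.left.y₂ = 0}
  one_mem' := ⟨rfl, rfl⟩
  mul_mem' := by
    rintro a b ⟨ha₁, ha₂⟩ ⟨hb₁, hb₂⟩
    have h := y_apply_eq_zero a.right.2 hb₁ hb₂
    exact ⟨by simp [ha₁, h.1], by simp [ha₂, h.2]⟩
  inv_mem' := by
    rintro a ⟨ha₁, ha₂⟩
    have h := y_apply_eq_zero (a := a.left⁻¹) (inv_mem a.right.2) (by simp [ha₁]) (by simp [ha₂])
    simpa using h

theorem index_polarization : polarization.index = 9 := by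
  let f : ZMod 3 × ZMod 3 → HeisShear ⧸ polarization := fun b ↦
    QuotientGroup.mk (inl ⟨0, 0, b.1, b.2, 0⟩)
  have hf : Function.Bijective f := by
    constructor
    · rintro ⟨b₁, b₂⟩ ⟨c₁, c₂⟩ h
      rw [QuotientGroup.eq, ← map_inv, ← map_mul] at h
      have h₁ : -b₁ + c₁ = 0 := h.1
      have h₂ : -b₂ + c₂ = 0 := h.2
      rw [neg_add_eq_zero.mp h₁, neg_add_eq_zero.mp h₂]
    · intro q
      obtain ⟨g, rfl⟩ := QuotientGroup.mk_surjective q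
      refine ⟨(g.left.y₁, g.left.y₂), ?_⟩
      rw [QuotientGroup.eq, ← map_inv]
      constructor <;> simp
  rw [Subgroup.index, ← Nat.card_congr (Equiv.ofBijective f hf)]
  simp

theorem eq_zero_of_apply_mkX_eq_one {χ : lagrangian →* ℂ} (hχ : χ (mkX 0 0 1) ≠ 1) {z : ZMod 3}
    (hz : χ (mkX 0 0 z) = 1) : z = 0 := by
  by_contra h
  refine hχ ?_
  have : mkX 0 0 1 = mkX 0 0 z ^ (z⁻¹).val := by
    rw [mkX_pow, ZMod.natCast_val, ZMod.cast_id, inv_mul_cancel₀ h, mul_zero]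
  rw [this, map_pow, hz, one_pow]

theorem finrank_eq_nine_of_weight {V : Type} [AddCommGroup V] [Module ℂ V]
    [FiniteDimensional ℂ V]
    (ρ : Representation ℂ HeisShear V) [ρ.IsIrreducible] {χ : lagrangian →* ℂ} {v : V}
    (hv : v ≠ 0) (hχ : ∀ n : lagrangian, ρ n v = χ n • v) (hz : χ (mkX 0 0 1) ≠ 1)
    (hx₁ : χ (mkX 1 0 0) = 1) (hx₂ : χ (mkX 0 1 0) = 1) : Module.finrank ℂ V = 9 := by
  have hX (x₁ x₂ z) : χ (mkX x₁ x₂ z) = χ (mkX 0 0 z) := by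
    have : mkX x₁ x₂ z = mkX 1 0 0 ^ x₁.val * mkX 0 1 0 ^ x₂.val * mkX 0 0 z := by
      simp [mkX_pow, mkX_mul]
    rw [this, map_mul, map_mul, map_pow, map_pow, hx₁, hx₂, one_pow, one_pow, one_mul, one_mul]
  have hconj {g : HeisShear} {x₁ x₂ z x₁' x₂' z' : ZMod 3}
      (h : g * inl (ofX x₁ x₂ z) * g⁻¹ = inl (ofX x₁' x₂' z')) :
      MulAut.conjNormal g (mkX x₁ x₂ z) = mkX x₁' x₂' z' := Subtype.ext h
  rw [← index_polarization]
  refine Representation.finrank_eq_index_of_weight ρ χ hv hχ (h := gen) (fun g ↦ ⟨?_, ?_⟩)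
    ⟨rfl, rfl⟩ ?_
  · rintro ⟨h₁, h₂⟩ n
    obtain ⟨x₁, x₂, z, rfl⟩ := exists_mkX_eq n
    obtain ⟨x₁', x₂', h⟩ := exists_conj_inl_ofX g x₁ x₂
    rw [hconj (h z), hX, hX x₁, h₁, h₂]
    simp
  · intro h
    have key (x₁ x₂) : g.left.y₁ * x₁ + g.left.y₂ * x₂ = 0 := by
      obtain ⟨x₁', x₂', h'⟩ := exists_conj_inl_ofX_eq g x₁ x₂
      refine eq_zero_of_apply_mkX_eq_one hz ?_
      have := h (mkX x₁' x₂' 0)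
      rw [hconj (h' 0), hX, hX x₁', zero_add] at this
      exact this.trans χ.map_one
    exact ⟨by simpa using key 1 0, by simpa using key 0 1⟩
  · rintro g ⟨h₁, h₂⟩
    obtain ⟨m, hm⟩ := exists_inr_eq_gen_pow g.right
    refine ⟨inl g.left, ⟨g.left.x₁, g.left.x₂, g.left.z, ?_⟩, m, ?_⟩
    · congr 1
      ext <;> simp [ofX, h₁, h₂]
    · rw [← hm, inl_left_mul_inr_right]

theorem finrank_eq_nine {V : Type} [AddCommGroup V] [Module ℂ V] [FiniteDimensional ℂ V]
    (ρ : Representation ℂ HeisShear V) [ρ.IsIrreducible] (hρ : ρ (inl (ofZ 1)) ≠ 1) :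
    Module.finrank ℂ V = 9 := by
  have : Nontrivial V := Representation.nontrivial_of_isIrreducible ρ
  obtain ⟨χ, v, hv, hχ⟩ := Representation.exists_weight_of_commute (ρ.comp lagrangian.subtype)
    fun g h ↦ (lagrangian_commute g h).map (ρ.comp lagrangian.subtype)
  replace hχ : ∀ n : lagrangian, ρ n v = χ n • v := hχ
  have hz : χ (mkX 0 0 1) ≠ 1 := fun h ↦ hρ <|
    Representation.apply_eq_one_of_mem_center ρ (inl_ofZ_mem_center 1) hv <| by
      have := hχ (mkX 0 0 1)
      rwa [h, one_smul] at this
  have hcube (a : lagrangian) : χ a ^ 3 = 1 := by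
    obtain ⟨x₁, x₂, z, rfl⟩ := exists_mkX_eq a
    rw [← map_pow, mkX_pow]
    have h3 : ((3 : ℕ) : ZMod 3) = 0 := rfl
    rw [h3, zero_mul, zero_mul, zero_mul]
    exact χ.map_one
  have hprim : IsPrimitiveRoot (χ (mkX 0 0 1)) 3 :=
    IsPrimitiveRoot.iff_orderOf.mpr (orderOf_eq_prime (hcube _) hz)
  have hex (a : lagrangian) : ∃ t : ZMod 3, χ (mkX 0 0 t) = χ a := by
    obtain ⟨i, -, hi⟩ := hprim.eq_pow_of_pow_eq_one (hcube a)
    refine ⟨i, ?_⟩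
    rw [← hi, ← map_pow, mkX_pow, mul_zero, mul_one]
  obtain ⟨t₁, ht₁⟩ := hex (mkX 1 0 0)
  obtain ⟨t₂, ht₂⟩ := hex (mkX 0 1 0)
  have hone {b c : lagrangian} (h : χ (b * c) = χ c) : χ b = 1 := by
    have hc : χ c ≠ 0 := fun h0 ↦ by simpa [h0] using hcube c
    rwa [map_mul, mul_eq_right₀ hc] at h
  let g : HeisShear := inl ⟨0, 0, t₁, t₂, 0⟩
  have hg (x₁ x₂ z) : MulAut.conjNormal g⁻¹ (mkX x₁ x₂ z) =
      mkX x₁ x₂ (z - (t₁ * x₁ + t₂ * x₂)) := by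
    refine Subtype.ext ?_
    rw [MulAut.conjNormal_apply, mkX, ← map_inv, ← map_inv, ← map_mul, ← map_mul, conj_ofX]
    simp only [mkX, y₁_inv, y₂_inv]
    congr 2
    ring
  refine finrank_eq_nine_of_weight ρ (v := ρ g v)
    (χ := χ.comp (MulAut.conjNormal g⁻¹ : MulAut lagrangian).toMonoidHom) ?_ ?_ ?_ ?_ ?_
  · intro h
    refine hv ?_
    rw [← ρ.inv_self_apply g v, h, map_zero]
  · intro n
    have := hχ (MulAut.conjNormal g⁻¹ n)
    rw [MulAut.conjNormal_apply] at this
    simp only [map_mul, Module.End.mul_apply, inv_inv] at this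
    have := congrArg (ρ g) this
    rwa [ρ.self_inv_apply, map_smul] at this
  · change χ (MulAut.conjNormal g⁻¹ (mkX 0 0 1)) ≠ 1
    rw [hg]
    simpa using hz
  · refine hone (b := MulAut.conjNormal g⁻¹ (mkX 1 0 0)) (c := mkX 0 0 t₁) ?_
    rw [hg, mkX_mul, ht₁]
    simp
  · refine hone (b := MulAut.conjNormal g⁻¹ (mkX 0 1 0)) (c := mkX 0 0 t₂) ?_
    rw [hg, mkX_mul, ht₂]
    simp

theorem finrank_dvd_nine {V : Type} [AddCommGroup V] [Module ℂ V] [FiniteDimensional ℂ V]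
    (ρ : Representation ℂ HeisShear V) [ρ.IsIrreducible] : Module.finrank ℂ V ∣ 9 := by
  by_cases hρ : ρ (inl (ofZ 1)) = 1
  · have : Nontrivial V := Representation.nontrivial_of_isIrreducible ρ
    have := isCyclic_quotient_base
    have hZ (t : ZMod 3) : ρ (inl (ofZ t)) = 1 := by
      have : ofZ t = ofZ 1 ^ t.val := by rw [ofZ_pow]; simp
      rw [this, map_pow, map_pow, hρ, one_pow]
    have hcomm (g h : base) : Commute (ρ g) (ρ h) := by
      obtain ⟨a, rfl⟩ := baseEquiv.surjective g
      obtain ⟨b, rfl⟩ := baseEquiv.surjective h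
      have : a * b = ⁅a, b⁆ * (b * a) := by rw [commutatorElement_def]; group
      rw [Commute, SemiconjBy, coe_baseEquiv, coe_baseEquiv, ← map_mul, ← map_mul, ← map_mul,
        ← map_mul, this, commutatorElement_eq, map_mul, map_mul, hZ, one_mul]
    obtain ⟨χ, v, hv, hχ⟩ :=
      Representation.exists_weight_of_commute (ρ.comp base.subtype) hcomm
    rw [Representation.finrank_eq_index_weightStabilizer ρ χ hv hχ, ← index_base]
    exact Subgroup.index_dvd_of_le (Representation.le_weightStabilizer χ)
  · rw [finrank_eq_nine ρ hρ]

theorem one_mem_charDegrees : 1 ∈ charDegrees HeisShear := by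
  have := isCyclic_quotient_base
  obtain ⟨V, v, hV, hv, hχ⟩ := FDRep.exists_simple_weight (k := ℂ) base 1
  have := FDRep.isIrreducible_of_simple V
  refine ⟨V, hV, ?_⟩
  rw [Representation.finrank_eq_index_weightStabilizer V.ρ _ hv hχ, Subgroup.index_eq_one,
    Subgroup.eq_top_iff']
  exact fun g n ↦ rfl

theorem stdAddChar_ne_one {t : ZMod 3} (ht : t ≠ 0) : ZMod.stdAddChar t ≠ 1 := fun h ↦
  ht <| ZMod.injective_stdAddChar <| h.trans (AddChar.map_zero_eq_one _).symm

/-- The linear character of the Heisenberg group given by the last symplectic coordinate. -/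
noncomputable def baseChar : base →* ℂ :=
  (⟨⟨fun a ↦ ZMod.stdAddChar a.y₂, AddChar.map_zero_eq_one _⟩,
    fun a b ↦ AddChar.map_add_eq_mul _ a.y₂ b.y₂⟩ : Heis →* ℂ).comp baseEquiv.symm.toMonoidHom

theorem baseChar_baseEquiv (a : Heis) : baseChar (baseEquiv a) = ZMod.stdAddChar a.y₂ := by
  change ZMod.stdAddChar (baseEquiv.symm (baseEquiv a)).y₂ = _
  rw [MulEquiv.symm_apply_apply]

theorem conjNormal_gen_baseEquiv (a : Heis) :
    MulAut.conjNormal gen (baseEquiv a) = baseEquiv (shear a) :=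
  Subtype.ext (gen_mul_inl_mul_inv a)

theorem gen_notMem_weightStabilizer : gen ∉ Representation.weightStabilizer baseChar := by
  intro h
  have := h (baseEquiv ⟨0, 0, -1, 0, 0⟩)
  rw [conjNormal_gen_baseEquiv, baseChar_baseEquiv, baseChar_baseEquiv] at this
  exact absurd (ZMod.injective_stdAddChar this) (by decide)

theorem gen_pow_three_mem_weightStabilizer :
    gen ^ 3 ∈ Representation.weightStabilizer baseChar := by
  intro n
  obtain ⟨a, rfl⟩ := baseEquiv.surjective n
  rw [map_pow, pow_succ, pow_two, MulAut.mul_apply, MulAut.mul_apply, conjNormal_gen_baseEquiv,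
    conjNormal_gen_baseEquiv, conjNormal_gen_baseEquiv, baseChar_baseEquiv, baseChar_baseEquiv,
    ← MulAut.mul_apply, ← MulAut.mul_apply, ← pow_two, ← pow_succ, shear_pow_three_apply]

theorem gen_pow_three_notMem_base : gen ^ 3 ∉ base := by
  rw [gen, ← map_pow, MonoidHom.mem_ker, rightHom_inr]
  intro h
  have := orderOf_dvd_of_pow_eq_one (congrArg Subtype.val h : shear ^ 3 = 1)
  rw [orderOf_shear] at this
  omega

theorem index_weightStabilizer_baseChar :
    (Representation.weightStabilizer baseChar).index = 3 := by
  have hle := Representation.le_weightStabilizer baseChar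
  have hdvd : (Representation.weightStabilizer baseChar).index ∣ 3 ^ 2 :=
    (Subgroup.index_dvd_of_le hle).trans index_base.dvd
  have hlt := Subgroup.index_strictAnti (lt_of_le_of_ne hle fun h ↦
    gen_pow_three_notMem_base (h ▸ gen_pow_three_mem_weightStabilizer))
  rw [index_base] at hlt
  have hne : (Representation.weightStabilizer baseChar).index ≠ 1 := fun h ↦
    gen_notMem_weightStabilizer (Subgroup.index_eq_one.mp h ▸ Subgroup.mem_top _)
  obtain ⟨k, hk, h⟩ := (Nat.dvd_prime_pow Nat.prime_three).mp hdvd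
  rw [h] at hlt hne ⊢
  interval_cases k <;> omega

theorem three_mem_charDegrees : 3 ∈ charDegrees HeisShear := by
  have := isCyclic_quotient_base
  obtain ⟨V, v, hV, hv, hχ⟩ := FDRep.exists_simple_weight base baseChar
  have := FDRep.isIrreducible_of_simple V
  exact ⟨V, hV, by rw [Representation.finrank_eq_index_weightStabilizer V.ρ _ hv hχ,
    index_weightStabilizer_baseChar]⟩

/-- A linear character of `lagrangian` that is nontrivial on the center. -/
noncomputable def lagrangianChar : lagrangian →* ℂ where
  toFun a := ZMod.stdAddChar (a : HeisShear).left.z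
  map_one' := AddChar.map_zero_eq_one _
  map_mul' a b := by
    obtain ⟨x₁, x₂, z, rfl⟩ := exists_mkX_eq a
    obtain ⟨x₁', x₂', z', rfl⟩ := exists_mkX_eq b
    rw [mkX_mul]
    exact AddChar.map_add_eq_mul _ z z'

theorem nine_mem_charDegrees : 9 ∈ charDegrees HeisShear := by
  obtain ⟨V, v, hV, hv, hχ⟩ := FDRep.exists_simple_weight lagrangian lagrangianChar
  have := FDRep.isIrreducible_of_simple V
  refine ⟨V, hV, finrank_eq_nine V.ρ fun h ↦ ?_⟩
  have h₁ := hχ (mkX 0 0 1)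
  have h₂ : V.ρ (mkX 0 0 1 : HeisShear) = 1 := h
  rw [h₂, Module.End.one_apply] at h₁
  have h₃ : lagrangianChar (mkX 0 0 1) = 1 :=
    smul_left_injective ℂ hv (h₁.symm.trans (one_smul ℂ v).symm)
  exact stdAddChar_ne_one one_ne_zero h₃

theorem charDegrees_eq : charDegrees HeisShear = {1, 3, 9} := by
  ext d
  constructor
  · rintro ⟨V, hV, rfl⟩
    have := FDRep.isIrreducible_of_simple V
    have h : Module.finrank ℂ V ∣ 3 ^ 2 := finrank_dvd_nine V.ρ
    obtain ⟨k, hk, h⟩ := (Nat.dvd_prime_pow Nat.prime_three).mp h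
    rw [h]
    interval_cases k <;> simp
  · rintro (rfl | rfl | rfl)
    exacts [one_mem_charDegrees, three_mem_charDegrees, nine_mem_charDegrees]

end HeisShear

theorem exists_group_three_pow_seven_dl_three :
    ∃ (P : Type) (_ : Group P) (_ : Finite P),
      Nat.card P = 3 ^ 7 ∧
      derivedSeries P 2 ≠ ⊥ ∧ derivedSeries P 3 = ⊥ ∧
      ∃ (G : Subgroup P) (_ : G.Normal),
        IsExtraspecial 3 ↥G ∧ Nat.card ↥G = 3 ^ 5 ∧ (∀ g ∈ G, g ^ 3 = 1) ∧
        IsCyclic (P ⧸ G) ∧ Nat.card (P ⧸ G) = 9 ∧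
        charDegrees P = {1, 3, 9} := by
  exact ⟨HeisShear, inferInstance, inferInstance, HeisShear.card,
    HeisShear.derivedSeries_two_ne_bot, HeisShear.derivedSeries_three_eq_bot,
    HeisShear.base, inferInstance,
    Heis.isExtraspecial.of_mulEquiv HeisShear.baseEquiv, HeisShear.card_base,
    HeisShear.pow_three_of_mem_base, HeisShear.isCyclic_quotient_base, HeisShear.index_base,
    HeisShear.charDegrees_eq⟩
end

section
/- There exists an extraspecial 3-group G of order 3^5 and exponent 3 that admits an automorphism α of order 9 such that the semidirect product P = G ⋊ ⟨α⟩ (a group of order 3^7) has derived length exactly 3, i.e., P'' ≠ 1 and P''' = 1. -/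
open scoped commutatorElement

/-- The Heisenberg group over `ZMod 3` of the symplectic space with coordinates `a, b, c, d` and
form `a * d' - d * a' + b * c' - c * b'`; the coordinate `z` is central. -/
@[ext]
structure Heisenberg where
  a : ZMod 3
  b : ZMod 3
  c : ZMod 3
  d : ZMod 3
  z : ZMod 3

namespace Heisenberg

instance : DecidableEq Heisenberg := fun _ _ => decidable_of_iff _ Heisenberg.ext_iff.symm

/-- The coordinates of an element, as a tuple. -/
def equivProd : Heisenberg ≃ ZMod 3 × ZMod 3 × ZMod 3 × ZMod 3 × ZMod 3 where
  toFun g := (g.a, g.b, g.c, g.d, g.z)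
  invFun t := ⟨t.1, t.2.1, t.2.2.1, t.2.2.2.1, t.2.2.2.2⟩
  left_inv _ := rfl
  right_inv _ := rfl

instance : Finite Heisenberg := Finite.of_equiv _ equivProd.symm

theorem card_eq : Nat.card Heisenberg = 3 ^ 5 := by
  rw [Nat.card_congr equivProd]
  simp

instance : Mul Heisenberg :=
  ⟨fun g h => ⟨g.a + h.a, g.b + h.b, g.c + h.c, g.d + h.d,
    g.z + h.z + (g.a * h.d - g.d * h.a + g.b * h.c - g.c * h.b)⟩⟩

instance : One Heisenberg := ⟨⟨0, 0, 0, 0, 0⟩⟩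

instance : Inv Heisenberg := ⟨fun g => ⟨-g.a, -g.b, -g.c, -g.d, -g.z⟩⟩

theorem mul_def (g h : Heisenberg) : g * h = ⟨g.a + h.a, g.b + h.b, g.c + h.c, g.d + h.d,
    g.z + h.z + (g.a * h.d - g.d * h.a + g.b * h.c - g.c * h.b)⟩ := rfl

theorem one_def : (1 : Heisenberg) = ⟨0, 0, 0, 0, 0⟩ := rfl

theorem inv_def (g : Heisenberg) : g⁻¹ = ⟨-g.a, -g.b, -g.c, -g.d, -g.z⟩ := rfl

instance : Group Heisenberg := Group.ofLeftAxioms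
  (fun _ _ _ => by ext <;> simp only [mul_def] <;> ring)
  (fun _ => by ext <;> simp [mul_def, one_def])
  (fun _ => by ext <;> simp only [mul_def, one_def, inv_def] <;> ring)

theorem three_eq_zero : (3 : ZMod 3) = 0 := rfl

theorem pow_three (g : Heisenberg) : g ^ 3 = 1 := by
  ext <;> simp only [pow_succ, pow_zero, mul_def, one_def] <;> grind [three_eq_zero]

theorem commutatorElement_eq (g h : Heisenberg) :
    ⁅g, h⁆ = ⟨0, 0, 0, 0, 2 * (g.a * h.d - g.d * h.a + g.b * h.c - g.c * h.b)⟩ := by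
  ext <;> simp only [commutatorElement_def, mul_def, inv_def] <;> ring

theorem mem_center_iff {g : Heisenberg} :
    g ∈ Subgroup.center Heisenberg ↔ g.a = 0 ∧ g.b = 0 ∧ g.c = 0 ∧ g.d = 0 := by
  rw [Subgroup.mem_center_iff]
  constructor
  · intro h
    have ha := congrArg z (h ⟨0, 0, 0, 1, 0⟩)
    have hb := congrArg z (h ⟨0, 0, 1, 0, 0⟩)
    have hc := congrArg z (h ⟨0, 1, 0, 0, 0⟩)
    have hd := congrArg z (h ⟨1, 0, 0, 0, 0⟩)
    simp only [mul_def] at ha hb hc hd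
    grind [three_eq_zero]
  · rintro ⟨ha, hb, hc, hd⟩ h
    ext <;> simp [mul_def, ha, hb, hc, hd, add_comm]

theorem center_eq_commutator : Subgroup.center Heisenberg = commutator Heisenberg := by
  apply le_antisymm
  · intro g hg
    obtain ⟨ha, hb, hc, hd⟩ := mem_center_iff.1 hg
    have : g = ⁅(⟨2 * g.z, 0, 0, 0, 0⟩ : Heisenberg), ⟨0, 0, 0, 1, 0⟩⁆ := by
      rw [commutatorElement_eq]
      ext <;> grind [three_eq_zero]
    rw [this]
    exact Subgroup.commutator_mem_commutator (Subgroup.mem_top _) (Subgroup.mem_top _)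
  · refine Subgroup.commutator_le.2 fun g _ h _ => ?_
    rw [commutatorElement_eq, mem_center_iff]
    simp

theorem card_center : Nat.card (Subgroup.center Heisenberg) = 3 := by
  let e : Subgroup.center Heisenberg ≃ ZMod 3 :=
    { toFun := fun g => g.1.z
      invFun := fun t => ⟨⟨0, 0, 0, 0, t⟩, mem_center_iff.2 ⟨rfl, rfl, rfl, rfl⟩⟩
      left_inv := fun g => by
        obtain ⟨ha, hb, hc, hd⟩ := mem_center_iff.1 g.2
        ext <;> simp [ha, hb, hc, hd]
      right_inv := fun _ => rfl }
  rw [Nat.card_congr e, Nat.card_zmod]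

end Heisenberg

/-- A maximal subgroup not containing the center contains the derived subgroup, because together
with the center it generates the group. -/
theorem Subgroup.commutator_le_of_isCoatom_of_not_center_le {G : Type*} [Group G] {M : Subgroup G}
    (hM : IsCoatom M) (hZ : ¬ Subgroup.center G ≤ M) : _root_.commutator G ≤ M := by
  have htop : M ⊔ Subgroup.center G = ⊤ := hM.2 _ (left_lt_sup.2 hZ)
  refine Subgroup.commutator_le.2 fun x _ y _ => ?_
  obtain ⟨m, hm, u, hu, rfl⟩ := Subgroup.mem_sup_of_normal_right.1 (htop ▸ Subgroup.mem_top x)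
  obtain ⟨n, hn, v, hv, rfl⟩ := Subgroup.mem_sup_of_normal_right.1 (htop ▸ Subgroup.mem_top y)
  have hu' := Subgroup.mem_center_iff.1 hu
  have hv' := Subgroup.mem_center_iff.1 hv
  have : ⁅m * u, n * v⁆ = ⁅m, n⁆ := by
    rw [commutatorElement_def, commutatorElement_def, mul_inv_rev, mul_inv_rev]
    calc m * u * (n * v) * (u⁻¹ * m⁻¹) * (v⁻¹ * n⁻¹)
        = m * (u * (n * v)) * u⁻¹ * m⁻¹ * v⁻¹ * n⁻¹ := by group
      _ = m * n * (v * m⁻¹) * v⁻¹ * n⁻¹ := by rw [← hu' (n * v)]; group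
      _ = m * n * m⁻¹ * n⁻¹ := by rw [← hv' m⁻¹]; group
  rw [this, commutatorElement_def]
  exact M.mul_mem (M.mul_mem (M.mul_mem hm hn) (M.inv_mem hm)) (M.inv_mem hn)

/-- The kernel of a surjection onto a group of prime order contains the Frattini subgroup. -/
theorem MonoidHom.frattini_le_ker_of_prime_card {G H : Type*} [Group G] [Group H] (f : G →* H)
    (hf : Function.Surjective f) (hH : (Nat.card H).Prime) : frattini G ≤ f.ker := by
  have : Finite H := Nat.finite_of_card_ne_zero hH.ne_zero
  refine frattini_le_coatom ?_
  have hidx : f.ker.index = Nat.card H := by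
    rw [Subgroup.index_ker, MonoidHom.range_eq_top.2 hf, Subgroup.card_top]
  refine ⟨fun h => hH.one_lt.ne' (by rw [← hidx, h, Subgroup.index_top]), fun K hK => ?_⟩
  rcases hH.eq_one_or_self_of_dvd K.index (hidx ▸ Subgroup.index_dvd_of_le hK.le) with h | h
  · exact Subgroup.index_eq_one.1 h
  · have hrel := Subgroup.relIndex_mul_index hK.le
    rw [h, hidx] at hrel
    exact absurd (Subgroup.relIndex_eq_one.1 (Nat.eq_of_mul_eq_mul_right hH.pos
      (hrel.trans (one_mul _).symm))) (not_le_of_gt hK)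

namespace Heisenberg

theorem coord_eq_zero_of_mem_frattini (f : Heisenberg → ZMod 3)
    (hmul : ∀ g h, f (g * h) = f g + f h) (hf : Function.Surjective f) {g : Heisenberg}
    (hg : g ∈ frattini Heisenberg) : f g = 0 := by
  let F : Heisenberg →* Multiplicative (ZMod 3) :=
    MonoidHom.mk' (fun g => Multiplicative.ofAdd (f g)) fun g h => by rw [hmul, ofAdd_add]
  have hcard : (Nat.card (Multiplicative (ZMod 3))).Prime := by
    rw [Nat.card_congr Multiplicative.toAdd, Nat.card_zmod]
    exact Nat.prime_three
  have := F.frattini_le_ker_of_prime_card (Multiplicative.ofAdd.surjective.comp hf) hcard hg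
  exact Multiplicative.ofAdd.injective this

theorem commutator_eq_frattini : commutator Heisenberg = frattini Heisenberg := by
  apply le_antisymm
  · refine le_iInf₂ fun M hM => ?_
    by_cases hZ : Subgroup.center Heisenberg ≤ M
    · exact center_eq_commutator ▸ hZ
    · exact Subgroup.commutator_le_of_isCoatom_of_not_center_le hM hZ
  · intro g hg
    rw [← center_eq_commutator, mem_center_iff]
    exact ⟨coord_eq_zero_of_mem_frattini a (fun _ _ => rfl) (fun t => ⟨⟨t, 0, 0, 0, 0⟩, rfl⟩) hg,
      coord_eq_zero_of_mem_frattini b (fun _ _ => rfl) (fun t => ⟨⟨0, t, 0, 0, 0⟩, rfl⟩) hg,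
      coord_eq_zero_of_mem_frattini c (fun _ _ => rfl) (fun t => ⟨⟨0, 0, t, 0, 0⟩, rfl⟩) hg,
      coord_eq_zero_of_mem_frattini d (fun _ _ => rfl) (fun t => ⟨⟨0, 0, 0, t, 0⟩, rfl⟩) hg⟩

theorem isExtraspecial : IsExtraspecial 3 Heisenberg :=
  have : Fact (Nat.Prime 3) := ⟨Nat.prime_three⟩
  ⟨IsPGroup.of_card card_eq, center_eq_commutator, commutator_eq_frattini, card_center⟩

/-- The automorphism induced by a symplectic transformation with a single unipotent Jordan
block. -/
def jordanAut : MulAut Heisenberg where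
  toFun g := ⟨g.a + g.b + g.c, g.b + g.c, g.c - g.d, g.d, g.z⟩
  invFun g := ⟨g.a - g.b, g.b - g.c - g.d, g.c + g.d, g.d, g.z⟩
  left_inv g := by ext <;> simp only <;> ring
  right_inv g := by ext <;> simp only <;> ring
  map_mul' g h := by ext <;> simp only [mul_def] <;> ring

theorem jordanAut_apply (g : Heisenberg) :
    jordanAut g = ⟨g.a + g.b + g.c, g.b + g.c, g.c - g.d, g.d, g.z⟩ := rfl

theorem jordanAut_pow_three_apply (g : Heisenberg) :
    (jordanAut ^ 3) g = ⟨g.a - g.d, g.b, g.c, g.d, g.z⟩ := by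
  ext <;> simp only [pow_succ, pow_zero, one_mul, MulAut.mul_apply, jordanAut_apply] <;>
    grind [three_eq_zero]

theorem orderOf_jordanAut : orderOf jordanAut = 9 := by
  refine orderOf_eq_prime_pow (hp := ⟨Nat.prime_three⟩) (n := 1) (fun h => ?_) ?_
  · have := congrArg a (DFunLike.congr_fun h (⟨0, 0, 0, 1, 0⟩ : Heisenberg))
    rw [pow_one, jordanAut_pow_three_apply] at this
    exact absurd this (by decide)
  · refine MulEquiv.ext fun g => ?_
    rw [show 3 ^ (1 + 1) = 3 * 3 from rfl, pow_mul, _root_.pow_three]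
    simp only [MulAut.mul_apply, jordanAut_pow_three_apply, MulAut.one_apply]
    ext <;> grind [three_eq_zero]

end Heisenberg

namespace SemidirectProduct

theorem inl_mul_inv_mem_derivedSeries_one {N H : Type*} [Group N] [Group H] (φ : H →* MulAut N)
    (h : H) (n : N) : (inl (φ h n * n⁻¹) : N ⋊[φ] H) ∈ derivedSeries (N ⋊[φ] H) 1 := by
  have : (inl (φ h n * n⁻¹) : N ⋊[φ] H) = ⁅(inr h : N ⋊[φ] H), inl n⁆ := by
    rw [commutatorElement_def, map_mul, inl_aut, map_inv inl, map_inv inr]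
  rw [this, derivedSeries_one]
  exact Subgroup.commutator_mem_commutator (Subgroup.mem_top _) (Subgroup.mem_top _)

theorem derivedSeries_one_le_range_inl {N H : Type*} [Group N] [Group H] [IsMulCommutative H]
    (φ : H →* MulAut N) : derivedSeries (N ⋊[φ] H) 1 ≤ (inl : N →* N ⋊[φ] H).range := by
  rw [derivedSeries_one, range_inl_eq_ker_rightHom]
  refine Subgroup.commutator_le.2 fun x _ y _ => ?_
  rw [MonoidHom.mem_ker, map_commutatorElement, commutatorElement_eq_one_iff_mul_comm]
  exact mul_comm' _ _

theorem derivedSeries_three_eq_bot {N H : Type*} [Group N] [Group H] [IsMulCommutative H]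
    (φ : H →* MulAut N) (hN : commutator N ≤ Subgroup.center N) :
    derivedSeries (N ⋊[φ] H) 3 = ⊥ := by
  have h2 : derivedSeries (N ⋊[φ] H) 2 ≤ (Subgroup.center N).map inl := by
    refine Subgroup.commutator_le.2 fun x hx y hy => ?_
    obtain ⟨m, rfl⟩ := derivedSeries_one_le_range_inl φ hx
    obtain ⟨n, rfl⟩ := derivedSeries_one_le_range_inl φ hy
    rw [← map_commutatorElement]
    exact Subgroup.mem_map_of_mem _
      (hN (Subgroup.commutator_mem_commutator (Subgroup.mem_top _) (Subgroup.mem_top _)))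
  refine le_bot_iff.1 (Subgroup.commutator_le.2 fun x hx y hy => ?_)
  obtain ⟨m, hm, rfl⟩ := h2 hx
  obtain ⟨n, -, rfl⟩ := h2 hy
  rw [Subgroup.mem_bot, commutatorElement_eq_one_iff_mul_comm, ← map_mul, ← map_mul,
    Subgroup.mem_center_iff.1 hm n]

end SemidirectProduct

theorem exists_extraspecial_3group_with_order_nine_aut :
    ∃ (G : Type) (_ : Group G) (_ : Finite G),
      IsExtraspecial 3 G ∧ Nat.card G = 3 ^ 5 ∧ (∀ g : G, g ^ 3 = 1) ∧
      ∃ α : MulAut G, orderOf α = 9 ∧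
        Nat.card (G ⋊[(Subgroup.zpowers α).subtype] ↥(Subgroup.zpowers α)) = 3 ^ 7 ∧
        derivedSeries (G ⋊[(Subgroup.zpowers α).subtype] ↥(Subgroup.zpowers α)) 2 ≠ ⊥ ∧
        derivedSeries (G ⋊[(Subgroup.zpowers α).subtype] ↥(Subgroup.zpowers α)) 3 = ⊥ := by
  refine ⟨Heisenberg, inferInstance, inferInstance, Heisenberg.isExtraspecial, Heisenberg.card_eq,
    Heisenberg.pow_three, Heisenberg.jordanAut, Heisenberg.orderOf_jordanAut, ?_, fun hbot => ?_,
    SemidirectProduct.derivedSeries_three_eq_bot _ Heisenberg.center_eq_commutator.ge⟩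
  · rw [SemidirectProduct.card, Heisenberg.card_eq, Nat.card_zpowers, Heisenberg.orderOf_jordanAut]
    norm_num
  · have hmem (g : Heisenberg) := SemidirectProduct.inl_mul_inv_mem_derivedSeries_one
      (Subgroup.zpowers Heisenberg.jordanAut).subtype
      ⟨Heisenberg.jordanAut, Subgroup.mem_zpowers _⟩ g
    have hcomm := Subgroup.commutator_mem_commutator (hmem ⟨0, 0, 1, 0, 0⟩) (hmem ⟨0, 0, 0, 1, 0⟩)
    rw [← derivedSeries_succ, hbot, Subgroup.mem_bot, ← map_commutatorElement,
      ← map_one SemidirectProduct.inl, SemidirectProduct.inl_inj] at hcomm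
    exact absurd hcomm (by decide)
end
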